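/- Let E be a real Banach space, T > 0, 0 < α₀ < 1, r ≥ 1, N ≥ 2, and consider the graded mesh t_n = T(n/N)^r with step sizes τ_n = t_n − t_{n−1}, the associated Peano kernels K(s;θ), the nonuniform L1 weights a^{(n)}_{n−k} with exponent α₀, and the complementary discrete convolution kernels P^{(n)}_{n−k}. Let u : (0,T] → E be twice continuously differentiable with ‖u'(t)‖ ≤ C_u t^{α₀−1} and ‖u''(t)‖ ≤ C_u t^{α₀−2}, and let k̃ : (0,T] → ℝ be measurable with |k̃(t)| ≤ C_k t^{−α₀}(1 + |ln t|). Define (R₂)¹ = ∫_0^{t₁} k̃(t₁ − s)(∫_{t₁}^{s} u'(θ) dθ) ds and, for 2 ≤ n ≤ N, (R₂)ⁿ = ∫_0^{t₁} k̃(t_n − s)(∫_{t₁}^{s} u'(θ) dθ) ds + Σ_{j=2}^{n} ∫_{t_{j−1}}^{t_j} k̃(t_n − s)(∫_{t_{j−1}}^{t_j} K(s;θ) u''(θ) dθ) ds. Then there exists C, depending only on r, α₀, T, C_u, C_k, such that Σ_{n=1}^{m} P^{(m)}_{m−n} ‖(R₂)ⁿ‖ ≤ C (1 + ln N)² N^{−min{2,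 r(1+α₀)}} for every 1 ≤ m ≤ N. -/

import Mathlib

open MeasureTheory intervalIntegral

/-- `β_ν(t) = t^(ν-1)/Γ(ν)`. -/
noncomputable def betaK (ν t : ℝ) : ℝ := t ^ (ν - 1) / Real.Gamma ν

/-- The graded temporal mesh `t_n = T (n/N)^r`. -/
noncomputable def gm (T r : ℝ) (N n : ℕ) : ℝ := T * ((n : ℝ) / (N : ℝ)) ^ r

/-- The Peano kernel of the midpoint-type interpolation quadrature on `[t_{j-1}, t_j]`. -/
noncomputable def peanoK (T r : ℝ) (N j : ℕ) (s θ : ℝ) : ℝ :=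
  if θ ≤ s then
    (θ - gm T r N (j - 1)) * (s - gm T r N j) / (gm T r N j - gm T r N (j - 1))
  else
    (θ - gm T r N j) * (s - gm T r N (j - 1)) / (gm T r N j - gm T r N (j - 1))

/-- The nonuniform L1 weight `a^{(n)}_{n-k}` on the graded mesh. -/
noncomputable def L1w (T r α : ℝ) (N n k : ℕ) : ℝ :=
  (betaK (2 - α) (gm T r N n - gm T r N (k - 1)) - betaK (2 - α) (gm T r N n - gm T r N k)) /
    (gm T r N k - gm T r N (k - 1))

section Mesh

variable {T r : ℝ} {N : ℕ}

lemma gm_zero (hr : 1 ≤ r) : gm T r N 0 = 0 := by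
  simp [gm, Real.zero_rpow (by linarith : r ≠ 0)]

lemma gm_lt_gm (hT : 0 < T) (hr : 1 ≤ r) (hN : 0 < N) {a b : ℕ} (h : a < b) :
    gm T r N a < gm T r N b := by
  have hN' : (0 : ℝ) < N := by exact_mod_cast hN
  have h' : (a : ℝ) < b := by exact_mod_cast h
  unfold gm
  gcongr

lemma gm_le_gm (hT : 0 < T) (hr : 1 ≤ r) (hN : 0 < N) {a b : ℕ} (h : a ≤ b) :
    gm T r N a ≤ gm T r N b := by
  rcases h.eq_or_lt with rfl | h
  · exact le_rfl
  · exact (gm_lt_gm hT hr hN h).le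

lemma gm_self (hN : 0 < N) : gm T r N N = T := by
  have hN' : (N : ℝ) ≠ 0 := by exact_mod_cast hN.ne'
  simp [gm, div_self hN']

lemma gm_pos (hT : 0 < T) (hr : 1 ≤ r) (hN : 0 < N) {n : ℕ} (h : 0 < n) : 0 < gm T r N n :=
  gm_zero (T := T) (N := N) hr ▸ gm_lt_gm hT hr hN h

lemma gm_nonneg (hT : 0 < T) (hr : 1 ≤ r) (hN : 0 < N) (n : ℕ) : 0 ≤ gm T r N n :=
  gm_zero (T := T) (N := N) hr ▸ gm_le_gm hT hr hN (Nat.zero_le n)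

lemma gm_le (hT : 0 < T) (hr : 1 ≤ r) (hN : 0 < N) {n : ℕ} (h : n ≤ N) : gm T r N n ≤ T :=
  (gm_le_gm hT hr hN h).trans_eq (gm_self hN)

/-- Each step of the graded mesh is at most `r t_n / n`. -/
lemma gm_step_le (hT : 0 < T) (hr : 1 ≤ r) {n : ℕ} (h : 1 ≤ n) :
    gm T r N n - gm T r N (n - 1) ≤ r * gm T r N n / n := by
  have hn : (1 : ℝ) ≤ n := by exact_mod_cast h
  have hB := one_add_mul_self_le_rpow_one_add (s := -(1 / (n : ℝ)))
    (by rw [neg_le_neg_iff, div_le_one (by linarith)]; exact hn) hr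
  have hs : gm T r N (n - 1) = gm T r N n * (1 + -(1 / (n : ℝ))) ^ r := by
    unfold gm
    rw [mul_assoc, ← Real.mul_rpow (by positivity)]
    · congr 2
      push_cast [Nat.cast_sub h]
      field_simp
      ring
    · have : 1 / (n : ℝ) ≤ 1 := by rw [div_le_one (by linarith)]; exact hn
      linarith
  have h0 : 0 ≤ gm T r N n := by unfold gm; positivity
  have := mul_le_mul_of_nonneg_left hB h0
  rw [hs]
  calc _ ≤ gm T r N n - gm T r N n * (1 + r * -(1 / (n : ℝ))) := by linarith
    _ = _ := by ring

/-- The smallest step of the graded mesh is the first one. -/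
lemma le_gm_step (hT : 0 < T) (hr : 1 ≤ r) {n : ℕ} (h : 1 ≤ n) :
    T * (N : ℝ) ^ (-r) ≤ gm T r N n - gm T r N (n - 1) := by
  have hn : (1 : ℝ) ≤ n := by exact_mod_cast h
  have hA := Real.add_rpow_le_rpow_add (a := (n : ℝ) - 1) (b := 1) (by linarith) zero_le_one hr
  rw [Real.one_rpow, sub_add_cancel] at hA
  unfold gm
  rw [Nat.cast_sub h, Nat.cast_one, Real.div_rpow (by linarith) (by positivity),
    Real.div_rpow (by linarith) (by positivity), Real.rpow_neg (by positivity)]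
  have : 0 ≤ T * ((N : ℝ) ^ r)⁻¹ := by positivity
  have := mul_le_mul_of_nonneg_left hA this
  rw [div_eq_mul_inv, div_eq_mul_inv]
  linarith

lemma gm_le_two_rpow_mul (hT : 0 < T) (hr : 1 ≤ r) {n : ℕ} (h : 2 ≤ n) :
    gm T r N n ≤ 2 ^ r * gm T r N (n - 1) := by
  have hn : (2 : ℝ) ≤ n := by exact_mod_cast h
  unfold gm
  rw [Nat.cast_sub (by omega), Nat.cast_one, mul_left_comm, ← Real.mul_rpow (by norm_num)
    (div_nonneg (by linarith) (by positivity)), ← mul_div_assoc]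
  gcongr
  linarith

/-- Logarithms of the distances between mesh points are controlled by `log N`. -/
lemma one_add_abs_log_le (hT : 0 < T) (hr : 1 ≤ r) (hN : 0 < N) {x : ℝ}
    (hx : T * (N : ℝ) ^ (-r) ≤ x) (hxT : x ≤ T) :
    1 + |Real.log x| ≤ (1 + |Real.log T| + r) * (1 + Real.log N) := by
  have hN' : (0 : ℝ) < N := by exact_mod_cast hN
  have hL : 0 ≤ Real.log N := Real.log_nonneg (by exact_mod_cast hN)
  have hp : 0 < T * (N : ℝ) ^ (-r) := by positivity
  have h1 := Real.log_le_log hp hx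
  have h2 := Real.log_le_log (hp.trans_le hx) hxT
  rw [Real.log_mul hT.ne' (by positivity), Real.log_rpow hN'] at h1
  have h3 : |Real.log x| ≤ |Real.log T| + r * Real.log N := by
    have := mul_nonneg (by linarith : 0 ≤ r) hL
    rw [abs_le]
    constructor
    · linarith [neg_abs_le (Real.log T)]
    · linarith [le_abs_self (Real.log T)]
  nlinarith [mul_nonneg (abs_nonneg (Real.log T)) hL]

end Mesh

section Weights

variable {T r α : ℝ} {N : ℕ}

lemma step_mul_L1w (hT : 0 < T) (hr : 1 ≤ r) (hN : 0 < N) (h1 : α < 1) {n j : ℕ} (hj : 1 ≤ j) :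
    Real.Gamma (2 - α) * ((gm T r N j - gm T r N (j - 1)) * L1w T r α N n j) =
      (gm T r N n - gm T r N (j - 1)) ^ (1 - α) - (gm T r N n - gm T r N j) ^ (1 - α) := by
  have hτ : gm T r N j - gm T r N (j - 1) ≠ 0 :=
    (sub_pos.2 (gm_lt_gm hT hr hN (by omega))).ne'
  have hG : Real.Gamma (2 - α) ≠ 0 := (Real.Gamma_pos_of_pos (by linarith)).ne'
  unfold L1w betaK
  rw [mul_div_cancel₀ _ hτ, show 2 - α - 1 = 1 - α by ring]
  field_simp

lemma L1w_pos (hT : 0 < T) (hr : 1 ≤ r) (hN : 0 < N) (h1 : α < 1) {n j : ℕ} (hj : 1 ≤ j)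
    (hjn : j ≤ n) : 0 < L1w T r α N n j := by
  have hτ : 0 < gm T r N j - gm T r N (j - 1) := sub_pos.2 (gm_lt_gm hT hr hN (by omega))
  have hG : 0 < Real.Gamma (2 - α) := Real.Gamma_pos_of_pos (by linarith)
  have hn := gm_le_gm hT hr hN hjn
  unfold L1w betaK
  refine div_pos (sub_pos.2 ?_) hτ
  gcongr
  · linarith
  · linarith

lemma L1w_le_succ (hT : 0 < T) (hr : 1 ≤ r) (hN : 0 < N) (h0 : 0 < α) (h1 : α < 1) {n k : ℕ}
    (hk : 1 ≤ k) (hkn : k + 1 ≤ n) : L1w T r α N n k ≤ L1w T r α N n (k + 1) := by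
  have hτ := gm_lt_gm hT hr hN (show k - 1 < k by omega)
  have hτ' := gm_lt_gm hT hr hN (show k < k + 1 by omega)
  have hn := gm_le_gm hT hr hN hkn
  have hG : 0 < Real.Gamma (2 - α) := Real.Gamma_pos_of_pos (by linarith)
  have hc := (Real.concaveOn_rpow (p := 1 - α) (by linarith) (by linarith)).slope_anti_adjacent
    (x := gm T r N n - gm T r N (k + 1)) (y := gm T r N n - gm T r N k)
    (z := gm T r N n - gm T r N (k - 1)) (by simpa using hn)
    (by simp only [Set.mem_Ici]; linarith) (by linarith) (by linarith)
  unfold L1w betaK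
  rw [show 2 - α - 1 = 1 - α by ring, Nat.add_sub_cancel, ← sub_div, ← sub_div, div_right_comm,
    div_right_comm _ (Real.Gamma _)]
  gcongr ?_ / _
  convert hc using 2 <;> ring

variable {P : ℕ → ℕ → ℝ}

lemma compl_kernel_nonneg (hT : 0 < T) (hr : 1 ≤ r) (hN : 0 < N) (h0 : 0 < α) (h1 : α < 1)
    (hP0 : ∀ n : ℕ, 1 ≤ n → n ≤ N → P n 0 = 1 / L1w T r α N n n)
    (hP : ∀ n k : ℕ, 1 ≤ k → k + 1 ≤ n → n ≤ N →
      P n (n - k) = (1 / L1w T r α N k k) *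
        ∑ j ∈ Finset.Icc (k + 1) n, (L1w T r α N j (k + 1) - L1w T r α N j k) * P n (n - j))
    {n : ℕ} (hn : n ≤ N) {k : ℕ} (hk : 1 ≤ k) (hkn : k ≤ n) : 0 ≤ P n (n - k) := by
  induction hd : n - k using Nat.strong_induction_on generalizing k with
  | _ d ih =>
    subst hd
    rcases hkn.eq_or_lt with rfl | hlt
    · rw [Nat.sub_self, hP0 k hk hn]
      exact (one_div_pos.2 (L1w_pos hT hr hN h1 hk le_rfl)).le
    · rw [hP n k hk hlt hn]
      refine mul_nonneg (one_div_pos.2 (L1w_pos hT hr hN h1 hk le_rfl)).le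
        (Finset.sum_nonneg fun j hj => ?_)
      rw [Finset.mem_Icc] at hj
      exact mul_nonneg (sub_nonneg.2 (L1w_le_succ hT hr hN h0 h1 hk hj.1))
        (ih (n - j) (by omega) (by omega) hj.2 rfl)

/-- The defining identity of the complementary discrete convolution kernels. -/
lemma compl_kernel_sum (hT : 0 < T) (hr : 1 ≤ r) (hN : 0 < N) (h1 : α < 1)
    (hP0 : ∀ n : ℕ, 1 ≤ n → n ≤ N → P n 0 = 1 / L1w T r α N n n)
    (hP : ∀ n k : ℕ, 1 ≤ k → k + 1 ≤ n → n ≤ N →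
      P n (n - k) = (1 / L1w T r α N k k) *
        ∑ j ∈ Finset.Icc (k + 1) n, (L1w T r α N j (k + 1) - L1w T r α N j k) * P n (n - j))
    {n : ℕ} (hn : n ≤ N) {k : ℕ} (hk : 1 ≤ k) (hkn : k ≤ n) :
    ∑ j ∈ Finset.Icc k n, P n (n - j) * L1w T r α N j k = 1 := by
  induction hkn using Nat.decreasingInduction with
  | self =>
    rw [Finset.Icc_self, Finset.sum_singleton, Nat.sub_self, hP0 n hk hn]
    exact one_div_mul_cancel (L1w_pos hT hr hN h1 hk le_rfl).ne'
  | of_succ k hkn ih =>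
    have hk0 := (L1w_pos (α := α) hT hr hN h1 hk le_rfl).ne'
    rw [← Finset.add_sum_Ioc_eq_sum_Icc hkn.le, hP n k hk hkn hn, mul_right_comm,
      one_div_mul_cancel hk0, one_mul, ← ih (by omega), ← Finset.Icc_add_one_left_eq_Ioc,
      ← Finset.sum_add_distrib]
    refine Finset.sum_congr rfl fun j _ => ?_
    ring

end Weights

section KernelIntegral

lemma integral_sub_rpow {p a b c : ℝ} (hp : -1 < p) :
    ∫ s in a..b, (c - s) ^ p = ((c - a) ^ (p + 1) - (c - b) ^ (p + 1)) / (p + 1) := by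
  rw [intervalIntegral.integral_comp_sub_left (fun x => x ^ p) c, integral_rpow (Or.inl hp)]

lemma intervalIntegrable_sub_rpow {p a b c : ℝ} (hp : -1 < p) :
    IntervalIntegrable (fun s => (c - s) ^ p) volume a b := by
  have := (intervalIntegrable_rpow' (a := c - a) (b := c - b) hp).comp_sub_left c
  simpa using this

variable {E : Type*} [NormedAddCommGroup E] [NormedSpace ℝ E]

/-- Cells at positive distance from the singularity of a kernel of size `x^(-α) (1 + |log x|)`. -/
lemma norm_integral_kernel_le_of_lt {T α Ck G M a b c : ℝ} {k : ℝ → ℝ} {F : ℝ → E} (h1 : α < 1)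
    (hk : ∀ s ∈ Set.Ioc (0 : ℝ) T, |k s| ≤ Ck * s ^ (-α) * (1 + |Real.log s|)) (hCk : 0 ≤ Ck)
    (hab : a ≤ b) (hbc : b < c) (hcT : c - a ≤ T) (hF : ∀ s ∈ Set.Ioc a b, ‖F s‖ ≤ G)
    (hM : ∀ x, c - b ≤ x → x ≤ T → 1 + |Real.log x| ≤ M) :
    ‖∫ s in a..b, k (c - s) • F s‖ ≤
      G * Ck * M * (((c - a) ^ (1 - α) - (c - b) ^ (1 - α)) / (1 - α)) := by
  have hp : -1 < -α := by linarith
  have hI := integral_sub_rpow (a := a) (b := b) (c := c) hp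
  rw [show -α + 1 = 1 - α by ring] at hI
  rw [← hI, ← intervalIntegral.integral_const_mul]
  refine norm_integral_le_of_norm_le hab (ae_of_all _ fun s hs => ?_)
    ((intervalIntegrable_sub_rpow hp).const_mul _)
  have hx : 0 < c - s := by linarith [hs.2]
  have hxT : c - s ≤ T := by linarith [hs.1]
  have hG := hF s hs
  have hG0 : 0 ≤ G := (norm_nonneg _).trans hG
  have hpow : 0 ≤ (c - s) ^ (-α) := by positivity
  rw [norm_smul, Real.norm_eq_abs]
  calc |k (c - s)| * ‖F s‖ ≤ (Ck * (c - s) ^ (-α) * (1 + |Real.log (c - s)|)) * G := by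
        gcongr
        exact hk _ ⟨hx, hxT⟩
    _ ≤ (Ck * (c - s) ^ (-α) * M) * G := by
        gcongr
        exact hM _ (by linarith [hs.2]) hxT
    _ = _ := by ring

/-- The cell adjacent to the singularity of a kernel of size `x^(-α) (1 + |log x|)`. -/
lemma norm_integral_kernel_le_of_eq {T α Ck G M a c : ℝ} {k : ℝ → ℝ} {F : ℝ → E} (h1 : α < 1)
    (hk : ∀ s ∈ Set.Ioc (0 : ℝ) T, |k s| ≤ Ck * s ^ (-α) * (1 + |Real.log s|)) (hCk : 0 ≤ Ck)
    (hac : a < c) (hcT : c - a ≤ T) (hF : ∀ s ∈ Set.Ioc a c, ‖F s‖ ≤ G)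
    (hM : 1 + |Real.log (c - a)| ≤ M) :
    ‖∫ s in a..c, k (c - s) • F s‖ ≤
      G * Ck * ((M / (1 - α) + 4 / (1 - α) ^ 2) * (c - a) ^ (1 - α)) := by
  set ε := (1 - α) / 2 with hε
  have hε0 : 0 < ε := by linarith
  have hτ : 0 < c - a := sub_pos.2 hac
  have hp : -1 < -α := by linarith
  have hq : -1 < -α - ε := by linarith
  have hI := integral_sub_rpow (a := a) (b := c) (c := c) hp
  have hJ := integral_sub_rpow (a := a) (b := c) (c := c) hq
  rw [sub_self, Real.zero_rpow (by linarith), sub_zero, show -α + 1 = 1 - α by ring] at hI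
  rw [sub_self, Real.zero_rpow (by linarith), sub_zero, show -α - ε + 1 = ε by linarith] at hJ
  have hG0 : 0 ≤ G := (norm_nonneg _).trans (hF c ⟨hac, le_rfl⟩)
  have hInt := ((intervalIntegrable_sub_rpow (a := a) (b := c) (c := c) hp).const_mul M).add
    ((intervalIntegrable_sub_rpow (a := a) (b := c) (c := c) hq).const_mul ((c - a) ^ ε / ε))
  have hval : ∫ s in a..c, G * Ck * (M * (c - s) ^ (-α) + (c - a) ^ ε / ε * (c - s) ^ (-α - ε)) =
      G * Ck * ((M / (1 - α) + 4 / (1 - α) ^ 2) * (c - a) ^ (1 - α)) := by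
    rw [intervalIntegral.integral_const_mul, intervalIntegral.integral_add
      ((intervalIntegrable_sub_rpow hp).const_mul M) ((intervalIntegrable_sub_rpow hq).const_mul _),
      intervalIntegral.integral_const_mul, intervalIntegral.integral_const_mul, hI, hJ]
    have hsq : (c - a) ^ (1 - α) = (c - a) ^ ε * (c - a) ^ ε := by
      rw [← Real.rpow_add hτ]; congr 1; linarith
    have h1α : 1 - α = 2 * ε := by linarith
    rw [hsq, h1α]
    field_simp
    ring
  rw [← hval]
  refine norm_integral_le_of_norm_le hac.le ?_ (hInt.const_mul _)
  have hne : ∀ᵐ s : ℝ, s ≠ c := by simp [ae_iff]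
  filter_upwards [hne] with s hsc hs
  have hsc' : s < c := lt_of_le_of_ne hs.2 hsc
  have hx : 0 < c - s := by linarith
  have hxτ : c - s ≤ c - a := by linarith [hs.1]
  have hlog : 1 + |Real.log (c - s)| ≤ M + ((c - a) / (c - s)) ^ ε / ε := by
    have h2 := Real.log_le_rpow_div (x := (c - a) / (c - s)) (by positivity) hε0
    rw [Real.log_div hτ.ne' hx.ne'] at h2
    have h3 := Real.log_le_log hx hxτ
    have : |Real.log (c - s)| ≤ |Real.log (c - a)| + (Real.log (c - a) - Real.log (c - s)) := by
      rw [abs_le]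
      constructor
      · linarith [neg_abs_le (Real.log (c - a))]
      · linarith [le_abs_self (Real.log (c - a))]
    linarith
  have hpow : 0 ≤ (c - s) ^ (-α) := by positivity
  rw [norm_smul, Real.norm_eq_abs]
  calc |k (c - s)| * ‖F s‖ ≤ (Ck * (c - s) ^ (-α) * (1 + |Real.log (c - s)|)) * G := by
        have := hk (c - s) ⟨hx, by linarith⟩
        have hF' := hF s hs
        gcongr
    _ ≤ (Ck * (c - s) ^ (-α) * (M + ((c - a) / (c - s)) ^ ε / ε)) * G := by gcongr
    _ = _ := by
        rw [Real.div_rpow hτ.le hx.le, Real.rpow_sub hx]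
        ring

end KernelIntegral

section Interpolation

variable {E : Type*} [NormedAddCommGroup E] [NormedSpace ℝ E] {T r α Cu : ℝ} {N : ℕ}

lemma norm_integral_first_cell_le {u' : ℝ → E} (h0 : 0 < α) (hCu : 0 ≤ Cu) {t s : ℝ} (htT : t ≤ T)
    (hu' : ∀ s ∈ Set.Ioc (0 : ℝ) T, ‖u' s‖ ≤ Cu * s ^ (α - 1)) (hs : s ∈ Set.Ioc 0 t) :
    ‖∫ θ in t..s, u' θ‖ ≤ Cu * (t ^ α / α) := by
  have hp : -1 < α - 1 := by linarith
  rw [intervalIntegral.integral_symm, norm_neg]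
  have hs0 := hs.1
  calc ‖∫ θ in s..t, u' θ‖ ≤ ∫ θ in s..t, Cu * θ ^ (α - 1) :=
        norm_integral_le_of_norm_le hs.2
          (ae_of_all _ fun θ hθ => hu' θ ⟨hs.1.trans hθ.1, hθ.2.trans htT⟩)
          ((intervalIntegrable_rpow' hp).const_mul _)
    _ = Cu * ((t ^ α - s ^ α) / α) := by
        rw [intervalIntegral.integral_const_mul, integral_rpow (Or.inl hp), sub_add_cancel]
    _ ≤ _ := by
        have : 0 ≤ s ^ α := by positivity
        gcongr
        linarith

lemma abs_peanoK_le {j : ℕ} {s θ : ℝ} (hτ : gm T r N (j - 1) < gm T r N j)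
    (hs : s ∈ Set.Icc (gm T r N (j - 1)) (gm T r N j))
    (hθ : θ ∈ Set.Icc (gm T r N (j - 1)) (gm T r N j)) :
    |peanoK T r N j s θ| ≤ gm T r N j - gm T r N (j - 1) := by
  have hτ' : 0 < gm T r N j - gm T r N (j - 1) := sub_pos.2 hτ
  obtain ⟨hs1, hs2⟩ := hs
  obtain ⟨hθ1, hθ2⟩ := hθ
  unfold peanoK
  split_ifs
  all_goals
    rw [abs_div, abs_mul, abs_of_pos hτ', div_le_iff₀ hτ']
    exact mul_le_mul (abs_le.2 ⟨by linarith, by linarith⟩) (abs_le.2 ⟨by linarith, by linarith⟩)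
      (abs_nonneg _) hτ'.le

lemma norm_integral_peanoK_le {u'' : ℝ → E} (hT : 0 < T) (hr : 1 ≤ r) (hN : 0 < N) (h1 : α < 1)
    (hCu : 0 ≤ Cu) (hu'' : ∀ s ∈ Set.Ioc (0 : ℝ) T, ‖u'' s‖ ≤ Cu * s ^ (α - 2)) {j : ℕ}
    (hj : 2 ≤ j) (hjN : j ≤ N) {s : ℝ} (hs : s ∈ Set.Icc (gm T r N (j - 1)) (gm T r N j)) :
    ‖∫ θ in gm T r N (j - 1)..gm T r N j, peanoK T r N j s θ • u'' θ‖ ≤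
      Cu * (r ^ 2 * 2 ^ (r * (2 - α))) * (gm T r N j ^ α / (j : ℝ) ^ 2) := by
  have hτ := gm_lt_gm hT hr hN (show j - 1 < j by omega)
  have ht0 : 0 < gm T r N (j - 1) := gm_pos hT hr hN (by omega)
  have htj : 0 < gm T r N j := gm_pos hT hr hN (by omega)
  have hj0 : (0 : ℝ) < j := by exact_mod_cast (by omega : 0 < j)
  have hstep := gm_step_le (N := N) hT hr (show 1 ≤ j by omega)
  have htwo : gm T r N (j - 1) ^ (α - 2) ≤ 2 ^ (r * (2 - α)) * gm T r N j ^ (α - 2) := by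
    have h := Real.rpow_le_rpow_of_nonpos htj (gm_le_two_rpow_mul (N := N) hT hr hj)
      (by linarith : α - 2 ≤ 0)
    rw [Real.mul_rpow (by positivity) ht0.le, ← Real.rpow_mul (by norm_num)] at h
    have h2 : (2 : ℝ) ^ (r * (2 - α)) * 2 ^ (r * (α - 2)) = 1 := by
      rw [← Real.rpow_add (by norm_num), ← mul_add]
      simp
    calc _ = 2 ^ (r * (2 - α)) * (2 ^ (r * (α - 2)) * gm T r N (j - 1) ^ (α - 2)) := by
          rw [← mul_assoc, h2, one_mul]
      _ ≤ _ := by gcongr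
  have hsq : gm T r N j ^ α = gm T r N j ^ (α - 2) * gm T r N j ^ 2 := by
    rw [← Real.rpow_natCast, ← Real.rpow_add htj]
    norm_num
  calc _ ≤ (gm T r N j - gm T r N (j - 1)) * (Cu * gm T r N (j - 1) ^ (α - 2)) *
        |gm T r N j - gm T r N (j - 1)| := by
        refine norm_integral_le_of_norm_le_const fun θ hθ => ?_
        rw [Set.uIoc_of_le hτ.le] at hθ
        have hθ0 : 0 < θ := ht0.trans hθ.1
        rw [norm_smul, Real.norm_eq_abs]
        have hτ' := sub_pos.2 hτ
        gcongr
        · exact abs_peanoK_le hτ hs (Set.Ioc_subset_Icc_self hθ)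
        · refine (hu'' θ ⟨hθ0, hθ.2.trans (gm_le hT hr hN hjN)⟩).trans ?_
          exact mul_le_mul_of_nonneg_left
            (Real.rpow_le_rpow_of_nonpos ht0 hθ.1.le (by linarith)) hCu
    _ = Cu * gm T r N (j - 1) ^ (α - 2) * (gm T r N j - gm T r N (j - 1)) ^ 2 := by
        rw [abs_of_pos (sub_pos.2 hτ)]; ring
    _ ≤ Cu * (2 ^ (r * (2 - α)) * gm T r N j ^ (α - 2)) * (r * gm T r N j / j) ^ 2 := by
        have := (sub_pos.2 hτ).le
        gcongr
    _ = _ := by rw [hsq]; field_simp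

end Interpolation

/-- A weighted sum on the graded mesh, bounded through the harmonic sum. -/
lemma sum_gm_rpow_div_cube_le {T r α : ℝ} {N m : ℕ} (hT : 0 < T) (hN : 0 < N)
    (hm : m ≤ N) :
    ∑ j ∈ Finset.Icc 1 m, gm T r N j ^ (1 + α) / (j : ℝ) ^ 3 ≤
      T ^ (1 + α) * (1 + Real.log N) * (N : ℝ) ^ (-(min 2 (r * (1 + α)))) := by
  have hN' : (0 : ℝ) < N := by exact_mod_cast hN
  set q := min 2 (r * (1 + α)) with hq
  have hterm : ∀ j ∈ Finset.Icc 1 m, gm T r N j ^ (1 + α) / (j : ℝ) ^ 3 ≤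
      T ^ (1 + α) * (N : ℝ) ^ (-q) * (j : ℝ)⁻¹ := by
    intro j hj
    rw [Finset.mem_Icc] at hj
    have hj1 : (1 : ℝ) ≤ j := by exact_mod_cast hj.1
    have hjN : (j : ℝ) ≤ N := by exact_mod_cast hj.2.trans hm
    have hj0 : (0 : ℝ) < j := by linarith
    have e : gm T r N j ^ (1 + α) = T ^ (1 + α) * ((j : ℝ) / N) ^ (r * (1 + α)) := by
      unfold gm
      rw [Real.mul_rpow hT.le (by positivity), ← Real.rpow_mul (by positivity)]
    have hle : ((j : ℝ) / N) ^ (r * (1 + α)) ≤ (j : ℝ) ^ 2 * (N : ℝ) ^ (-q) := by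
      calc _ ≤ ((j : ℝ) / N) ^ q :=
            Real.rpow_le_rpow_of_exponent_ge (by positivity) ((div_le_one hN').2 hjN)
              (min_le_right _ _)
        _ = (j : ℝ) ^ q * (N : ℝ) ^ (-q) := by
            rw [Real.div_rpow hj0.le hN'.le, Real.rpow_neg hN'.le, div_eq_mul_inv]
        _ ≤ _ := by
            gcongr
            rw [← Real.rpow_natCast]
            exact Real.rpow_le_rpow_of_exponent_le hj1 (by exact_mod_cast min_le_left (2 : ℝ) (r * (1 + α)))
    rw [e]
    calc _ ≤ T ^ (1 + α) * ((j : ℝ) ^ 2 * (N : ℝ) ^ (-q)) / (j : ℝ) ^ 3 := by gcongr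
      _ = _ := by field_simp
  have hharm : ∑ j ∈ Finset.Icc 1 m, (j : ℝ)⁻¹ ≤ 1 + Real.log N := by
    have h := harmonic_le_one_add_log N
    rw [harmonic_eq_sum_Icc] at h
    push_cast at h
    refine le_trans (Finset.sum_le_sum_of_subset_of_nonneg (Finset.Icc_subset_Icc le_rfl hm)
      fun _ _ _ => by positivity) h
  calc _ ≤ ∑ j ∈ Finset.Icc 1 m, T ^ (1 + α) * (N : ℝ) ^ (-q) * (j : ℝ)⁻¹ :=
        Finset.sum_le_sum hterm
    _ = T ^ (1 + α) * (N : ℝ) ^ (-q) * ∑ j ∈ Finset.Icc 1 m, (j : ℝ)⁻¹ :=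
        (Finset.mul_sum _ _ _).symm
    _ ≤ T ^ (1 + α) * (N : ℝ) ^ (-q) * (1 + Real.log N) := by gcongr
    _ = _ := by ring

/-- One cell of the remainder, compared with the L1 weight of that cell. -/
lemma norm_integral_cell_le {E : Type*} [NormedAddCommGroup E] [NormedSpace ℝ E]
    {T r α Ck A : ℝ} {N : ℕ} (hT : 0 < T) (hr : 1 ≤ r) (hN : 0 < N) (h1 : α < 1)
    (hCk : 0 ≤ Ck) (hA : 0 ≤ A) {k : ℝ → ℝ}
    (hk : ∀ s ∈ Set.Ioc (0 : ℝ) T, |k s| ≤ Ck * s ^ (-α) * (1 + |Real.log s|)) {n j : ℕ}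
    (hj : 1 ≤ j) (hjn : j ≤ n) (hn : n ≤ N) {F : ℝ → E}
    (hF : ∀ s ∈ Set.Ioc (gm T r N (j - 1)) (gm T r N j),
      ‖F s‖ ≤ A * (gm T r N j ^ α / (j : ℝ) ^ 2)) :
    ‖∫ s in gm T r N (j - 1)..gm T r N j, k (gm T r N n - s) • F s‖ ≤
      A * Ck * ((1 + |Real.log T| + r) * (1 + Real.log N)) *
        (1 / (1 - α) + 4 / (1 - α) ^ 2) * Real.Gamma (2 - α) * r *
        (L1w T r α N n j * (gm T r N j ^ (1 + α) / (j : ℝ) ^ 3)) := by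
  have hj0 : (0 : ℝ) < j := by exact_mod_cast hj
  have htj : 0 < gm T r N j := gm_pos hT hr hN hj
  have hτ := gm_lt_gm hT hr hN (show j - 1 < j by omega)
  have hL : 0 ≤ Real.log N := Real.log_nonneg (by exact_mod_cast hN)
  have h1α : 0 < 1 - α := by linarith
  have hΓ : 0 < Real.Gamma (2 - α) := Real.Gamma_pos_of_pos (by linarith)
  have ha := (L1w_pos (α := α) hT hr hN h1 hj hjn).le
  have hw := step_mul_L1w (n := n) hT hr hN h1 hj
  have hprev := gm_nonneg hT hr hN (j - 1)
  have hnT := gm_le hT hr hN hn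
  set M := (1 + |Real.log T| + r) * (1 + Real.log N) with hMdef
  have hM : ∀ x, T * (N : ℝ) ^ (-r) ≤ x → x ≤ T → 1 + |Real.log x| ≤ M := fun x hx hxT =>
    one_add_abs_log_le hT hr hN hx hxT
  have hM1 : 1 ≤ M := by
    have := hM T (by
      have := le_gm_step (N := N) hT hr (show 1 ≤ n by omega)
      linarith [gm_nonneg hT hr hN (n - 1)]) le_rfl
    linarith [abs_nonneg (Real.log T)]
  set G := A * (gm T r N j ^ α / (j : ℝ) ^ 2) with hG
  have hG0 : 0 ≤ G := by positivity
  set W := (gm T r N n - gm T r N (j - 1)) ^ (1 - α) - (gm T r N n - gm T r N j) ^ (1 - α) with hW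
  have hW0 : 0 ≤ W := by
    rw [← hw]
    have := (sub_pos.2 hτ).le
    positivity
  have key : ‖∫ s in gm T r N (j - 1)..gm T r N j, k (gm T r N n - s) • F s‖ ≤
      G * Ck * (M * (1 / (1 - α) + 4 / (1 - α) ^ 2) * W) := by
    rcases hjn.eq_or_lt with rfl | hlt
    · refine (norm_integral_kernel_le_of_eq h1 hk hCk hτ (by linarith) hF
        (hM _ (le_gm_step hT hr hj) (by linarith))).trans ?_
      have hWe : W = (gm T r N j - gm T r N (j - 1)) ^ (1 - α) := by
        rw [hW, sub_self, Real.zero_rpow h1α.ne', sub_zero]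
      rw [← hWe]
      gcongr
      have : 4 / (1 - α) ^ 2 ≤ M * (4 / (1 - α) ^ 2) :=
        le_mul_of_one_le_left (by positivity) hM1
      calc _ ≤ M / (1 - α) + M * (4 / (1 - α) ^ 2) := by gcongr
        _ = _ := by ring
    · have hstep := le_gm_step (N := N) hT hr (show 1 ≤ n by omega)
      have hnj := gm_le_gm hT hr hN (show j ≤ n - 1 by omega)
      refine (norm_integral_kernel_le_of_lt h1 hk hCk hτ.le (gm_lt_gm hT hr hN hlt) (by linarith) hF
        (M := M) fun x hx hxT => hM x (by linarith) hxT).trans ?_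
      have h4 : 0 ≤ 4 / (1 - α) ^ 2 := by positivity
      calc _ = G * Ck * (M * (1 / (1 - α)) * W) := by ring
        _ ≤ _ := by gcongr; linarith
  refine key.trans ?_
  have hpow : gm T r N j ^ (1 + α) = gm T r N j * gm T r N j ^ α := by
    rw [Real.rpow_add htj, Real.rpow_one]
  have hstep := gm_step_le (N := N) hT hr hj
  rw [← hw]
  calc _ ≤ G * Ck * (M * (1 / (1 - α) + 4 / (1 - α) ^ 2) *
        (Real.Gamma (2 - α) * (r * gm T r N j / j * L1w T r α N n j))) := by gcongr
    _ = _ := by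
      rw [hpow, hG]
      field_simp

theorem stmt_12 (T α₀ r Cu Ck : ℝ) (hT : 0 < T) (h0 : 0 < α₀) (h1 : α₀ < 1) (hr : 1 ≤ r) :
    ∃ C > 0, ∀ (E : Type) [NormedAddCommGroup E] [NormedSpace ℝ E] [CompleteSpace E],
      ∀ N : ℕ, 2 ≤ N →
      ∀ P : ℕ → ℕ → ℝ,
        (∀ n : ℕ, 1 ≤ n → n ≤ N → P n 0 = 1 / L1w T r α₀ N n n) →
        (∀ n k : ℕ, 1 ≤ k → k + 1 ≤ n → n ≤ N →
          P n (n - k) = (1 / L1w T r α₀ N k k) *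
            ∑ j ∈ Finset.Icc (k + 1) n,
              (L1w T r α₀ N j (k + 1) - L1w T r α₀ N j k) * P n (n - j)) →
      ∀ (u u' u'' : ℝ → E) (k : ℝ → ℝ),
        (∀ s ∈ Set.Ioc (0:ℝ) T, HasDerivAt u (u' s) s) →
        (∀ s ∈ Set.Ioc (0:ℝ) T, HasDerivAt u' (u'' s) s) →
        ContinuousOn u'' (Set.Ioc 0 T) →
        (∀ s ∈ Set.Ioc (0:ℝ) T, ‖u' s‖ ≤ Cu * s ^ (α₀ - 1)) →
        (∀ s ∈ Set.Ioc (0:ℝ) T, ‖u'' s‖ ≤ Cu * s ^ (α₀ - 2)) →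
        Measurable k →
        (∀ s ∈ Set.Ioc (0:ℝ) T, |k s| ≤ Ck * s ^ (-α₀) * (1 + |Real.log s|)) →
        ∀ m : ℕ, 1 ≤ m → m ≤ N →
          ∑ n ∈ Finset.Icc 1 m, P m (m - n) *
            ‖(∫ s in (0:ℝ)..gm T r N 1, k (gm T r N n - s) • (∫ θ in (gm T r N 1)..s, u' θ)) +
                ∑ j ∈ Finset.Icc 2 n,
                  ∫ s in gm T r N (j - 1)..gm T r N j, k (gm T r N n - s) •
                    (∫ θ in gm T r N (j - 1)..gm T r N j, peanoK T r N j s θ • u'' θ)‖ ≤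
            C * (1 + Real.log (N : ℝ)) ^ 2 * (N : ℝ) ^ (-(min 2 (r * (1 + α₀)))) := by
  set D := (1 + |Real.log T| + r) * (1 / (1 - α₀) + 4 / (1 - α₀) ^ 2) * Real.Gamma (2 - α₀) * r
    with hD
  set B := 1 / α₀ + r ^ 2 * 2 ^ (r * (2 - α₀)) with hB
  refine ⟨|Cu * B * Ck * D * T ^ (1 + α₀)| + 1, by positivity, ?_⟩
  intro E _ _ _ N hN2 P hP0 hP u u' u'' k _ _ _ hu' hu'' _ hk m hm hmN
  have hN : 0 < N := by omega
  have hTT : T ∈ Set.Ioc (0 : ℝ) T := ⟨hT, le_rfl⟩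
  have hCu : 0 ≤ Cu :=
    nonneg_of_mul_nonneg_left ((norm_nonneg _).trans (hu' T hTT)) (by positivity)
  have hCk : 0 ≤ Ck := by
    have h := (abs_nonneg _).trans (hk T hTT)
    rw [mul_assoc] at h
    exact nonneg_of_mul_nonneg_left h (by positivity)
  have hB0 : 0 ≤ B := by positivity
  set L := 1 + Real.log (N : ℝ) with hL
  have hL0 : 0 ≤ L := by
    have : 0 ≤ Real.log N := Real.log_nonneg (by exact_mod_cast hN)
    linarith
  set w : ℕ → ℝ := fun j => gm T r N j ^ (1 + α₀) / (j : ℝ) ^ 3 with hw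
  have hcell : ∀ n j, 1 ≤ j → j ≤ n → n ≤ N → ∀ F : ℝ → E,
      (∀ s ∈ Set.Ioc (gm T r N (j - 1)) (gm T r N j),
        ‖F s‖ ≤ Cu * B * (gm T r N j ^ α₀ / (j : ℝ) ^ 2)) →
      ‖∫ s in gm T r N (j - 1)..gm T r N j, k (gm T r N n - s) • F s‖ ≤
        Cu * B * Ck * D * L * (L1w T r α₀ N n j * w j) := by
    intro n j hj hjn hn F hF
    refine (norm_integral_cell_le hT hr hN h1 hCk (by positivity) hk hj hjn hn hF).trans_eq ?_
    rw [hD]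
    ring
  have hR : ∀ n ∈ Finset.Icc 1 m,
      ‖(∫ s in (0:ℝ)..gm T r N 1, k (gm T r N n - s) • (∫ θ in (gm T r N 1)..s, u' θ)) +
          ∑ j ∈ Finset.Icc 2 n, ∫ s in gm T r N (j - 1)..gm T r N j, k (gm T r N n - s) •
            (∫ θ in gm T r N (j - 1)..gm T r N j, peanoK T r N j s θ • u'' θ)‖ ≤
        Cu * B * Ck * D * L * ∑ j ∈ Finset.Icc 1 n, L1w T r α₀ N n j * w j := by
    intro n hn
    rw [Finset.mem_Icc] at hn
    have hnN := hn.2.trans hmN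
    rw [← Finset.add_sum_Ioc_eq_sum_Icc hn.1, ← Finset.Icc_add_one_left_eq_Ioc, mul_add,
      Finset.mul_sum]
    refine (norm_add_le _ _).trans (add_le_add ?_ ((norm_sum_le _ _).trans
      (Finset.sum_le_sum fun j hj => ?_)))
    · have h := hcell n 1 le_rfl hn.1 hnN (fun s => ∫ θ in (gm T r N 1)..s, u' θ) ?_
      · rwa [Nat.sub_self, gm_zero hr] at h
      · intro s hs
        rw [Nat.sub_self, gm_zero hr] at hs
        refine (norm_integral_first_cell_le h0 hCu (gm_le hT hr hN (by omega)) hu' hs).trans ?_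
        have hpos : 0 ≤ gm T r N 1 ^ α₀ := Real.rpow_nonneg (gm_nonneg hT hr hN 1) _
        rw [Nat.cast_one, one_pow, div_one, mul_assoc, div_eq_mul_one_div, mul_comm (_ ^ α₀)]
        gcongr
        rw [hB]
        have : 0 ≤ r ^ 2 * 2 ^ (r * (2 - α₀)) := by positivity
        linarith
    · rw [Finset.mem_Icc] at hj
      refine hcell n j (by omega) hj.2 hnN
        (fun s => ∫ θ in gm T r N (j - 1)..gm T r N j, peanoK T r N j s θ • u'' θ) fun s hs => ?_
      refine (norm_integral_peanoK_le hT hr hN h1 hCu hu'' hj.1 (hj.2.trans hnN)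
        (Set.Ioc_subset_Icc_self hs)).trans ?_
      have hpos : 0 ≤ gm T r N j ^ α₀ := Real.rpow_nonneg (gm_nonneg hT hr hN j) _
      gcongr
      rw [hB]
      have : 0 ≤ 1 / α₀ := by positivity
      linarith
  have hswap : ∑ n ∈ Finset.Icc 1 m, P m (m - n) * ∑ j ∈ Finset.Icc 1 n, L1w T r α₀ N n j * w j =
      ∑ j ∈ Finset.Icc 1 m, w j := by
    simp_rw [Finset.mul_sum]
    rw [Finset.sum_comm' (t' := Finset.Icc 1 m) (s' := fun j => Finset.Icc j m)
      (by intro x y; simp only [Finset.mem_Icc]; omega)]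
    refine Finset.sum_congr rfl fun j hj => ?_
    rw [Finset.mem_Icc] at hj
    have h := compl_kernel_sum hT hr hN h1 hP0 hP hmN hj.1 hj.2
    calc _ = (∑ n ∈ Finset.Icc j m, P m (m - n) * L1w T r α₀ N n j) * w j := by
          rw [Finset.sum_mul]
          exact Finset.sum_congr rfl fun n _ => by ring
      _ = w j := by rw [h, one_mul]
  have hD0 : 0 ≤ D := by
    have h1α : 0 < 1 - α₀ := by linarith
    have hΓ : 0 < Real.Gamma (2 - α₀) := Real.Gamma_pos_of_pos (by linarith)
    positivity
  calc _ ≤ ∑ n ∈ Finset.Icc 1 m, P m (m - n) *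
        (Cu * B * Ck * D * L * ∑ j ∈ Finset.Icc 1 n, L1w T r α₀ N n j * w j) := by
        refine Finset.sum_le_sum fun n hn => mul_le_mul_of_nonneg_left (hR n hn) ?_
        rw [Finset.mem_Icc] at hn
        exact compl_kernel_nonneg hT hr hN h0 h1 hP0 hP hmN hn.1 hn.2
    _ = Cu * B * Ck * D * L * ∑ j ∈ Finset.Icc 1 m, w j := by
        rw [← hswap, Finset.mul_sum]
        exact Finset.sum_congr rfl fun n _ => by ring
    _ ≤ Cu * B * Ck * D * L *
        (T ^ (1 + α₀) * L * (N : ℝ) ^ (-(min 2 (r * (1 + α₀))))) := by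
        gcongr
        exact sum_gm_rpow_div_cube_le hT hN hmN
    _ = (Cu * B * Ck * D * T ^ (1 + α₀)) * L ^ 2 * (N : ℝ) ^ (-(min 2 (r * (1 + α₀)))) := by
        ring
    _ ≤ _ := by
        gcongr
        linarith [le_abs_self (Cu * B * Ck * D * T ^ (1 + α₀))]
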